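/- Let Γ be a finitely presented residually finite group with finite symmetric generating set S, let Γ ⊳ Γ_1 ⊳ Γ_2 ⊳ … be a nested sequence of finite-index normal subgroups with ∩_{n=1}^∞ Γ_n = {1} and [Γ:Γ_n] → ∞, let 𝒢 = {G_n} be the graph sequence of Cayley graphs of Γ/Γ_n with respect to the image of S, and let p be a prime. Then the mod p homology gradient liminf_{n→∞} d_p(Γ_n)/[Γ:Γ_n] equals β_{F_p}(𝒢), where d_p(Γ_n) = dim_{F_p} H_1(Γ_n, F_p) = dim_{F_p} Γ_n/([Γ_n,Γ_n]·Γ_n^p). -/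

import Mathlib

open Filter Function Set
open scoped Classical TensorProduct Pointwise symmDiff

universe u

namespace GraphSeqPaper

/-- The space of `K`-valued antisymmetric functions supported on the (oriented) edges of `G`:
the `K`-vector space spanned by the edges with the convention `(x,y) = -(y,x)`. -/
def edgeSpace (K : Type*) [Field K] {V : Type u} (G : SimpleGraph V) :
    Submodule K (V → V → K) where
  carrier := {f | (∀ x y, ¬ G.Adj x y → f x y = 0) ∧ ∀ x y, f x y = - f y x}
  add_mem' := by
    rintro f g ⟨hf1, hf2⟩ ⟨hg1, hg2⟩
    refine ⟨fun x y h => ?_, fun x y => ?_⟩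
    · simp only [Pi.add_apply, hf1 x y h, hg1 x y h, add_zero]
    · simp only [Pi.add_apply, hf2 x y, hg2 x y]; ring
  zero_mem' := ⟨fun x y _ => rfl, fun x y => by simp⟩
  smul_mem' := by
    rintro c f ⟨hf1, hf2⟩
    refine ⟨fun x y h => ?_, fun x y => ?_⟩
    · simp only [Pi.smul_apply, hf1 x y h, smul_zero]
    · simp only [Pi.smul_apply, hf2 x y, smul_neg]

lemma edgeSpace_mono (K : Type*) [Field K] {V : Type u} {H G : SimpleGraph V}
    (h : H ≤ G) : edgeSpace K H ≤ edgeSpace K G :=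
  fun f hf => ⟨fun x y hxy => hf.1 x y fun ha => hxy (h ha), hf.2⟩

/-- The basis vector of `ε_K` associated to the oriented edge `(x,y)`. -/
noncomputable def edgeVec (K : Type*) [Field K] {V : Type u} (x y : V) : V → V → K :=
  fun a b => if a = x ∧ b = y then (1 : K) else if a = y ∧ b = x then (-1 : K) else 0

/-- The vector of a walk `(x₀, x₁, …, x_l)`, namely `Σ_{i} (x_i, x_{i+1})`. -/
noncomputable def walkVec (K : Type*) [Field K] {V : Type u} {G : SimpleGraph V} :
    ∀ {x y : V}, G.Walk x y → (V → V → K)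
  | _, _, SimpleGraph.Walk.nil => 0
  | _, _, @SimpleGraph.Walk.cons _ _ a b _ _ p => edgeVec K a b + walkVec K p

/-- `C^q_K(G)`: the subspace of `ε_K(G)` spanned by the vectors of cycles of length at most
`q`. -/
noncomputable def cycleSpace (K : Type*) [Field K] {V : Type u} (G : SimpleGraph V) (q : ℕ) :
    Submodule K (V → V → K) :=
  Submodule.span K
    {f | ∃ (x : V) (c : G.Walk x x), c.IsCycle ∧ c.length ≤ q ∧ f = walkVec K c}

/-- A graph sequence: finite simple graphs, of uniformly bounded vertex degrees, whose number
of vertices tends to infinity. -/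
def IsGraphSeq (V : ℕ → Type u) (G : ∀ n, SimpleGraph (V n)) : Prop :=
  (∀ n, Finite (V n)) ∧
    (∃ D : ℕ, ∀ n (x : V n), ((G n).neighborSet x).ncard ≤ D) ∧
      Tendsto (fun n => Nat.card (V n)) atTop atTop

/-- `ℋ ≺ 𝒢`: there is an integer `L > 0` with `d_{G_n}(x,y) ≤ L · d_{H_n}(x,y)` for all `n`
and all vertices `x, y`. -/
def Prec {V : ℕ → Type u} (H G : ∀ n, SimpleGraph (V n)) : Prop :=
  ∃ L : ℕ, 0 < L ∧ ∀ n (x y : V n), (G n).dist x y ≤ L * (H n).dist x y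

/-- `𝒢 ≃ ℋ`: `ℋ ≺ 𝒢` and `𝒢 ≺ ℋ`. -/
def GEquiv {V : ℕ → Type u} (G H : ∀ n, SimpleGraph (V n)) : Prop :=
  Prec H G ∧ Prec G H

/-- The edge number `e(𝒢) = liminf |E(G_n)|/|V(G_n)|`. -/
noncomputable def edgeNum {V : ℕ → Type u} (G : ∀ n, SimpleGraph (V n)) : ℝ :=
  liminf (fun n => ((G n).edgeSet.ncard : ℝ) / (Nat.card (V n) : ℝ)) atTop

/-- The cost `c(𝒢) = inf { e(ℋ) : ℋ ≃ 𝒢 }`. -/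
noncomputable def cost {V : ℕ → Type u} (G : ∀ n, SimpleGraph (V n)) : ℝ :=
  sInf {r : ℝ | ∃ H : ∀ n, SimpleGraph (V n), IsGraphSeq V H ∧ GEquiv G H ∧ r = edgeNum H}

/-- `s^q_K(𝒢) = liminf (|E(G_n)| - dim_K C^q_K(G_n))/|V(G_n)| - 1`. -/
noncomputable def sInv (K : Type*) [Field K] {V : ℕ → Type u}
    (G : ∀ n, SimpleGraph (V n)) (q : ℕ) : ℝ :=
  liminf (fun n =>
    (((G n).edgeSet.ncard : ℝ) - (Module.finrank K (cycleSpace K (G n) q) : ℝ)) /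
      (Nat.card (V n) : ℝ)) atTop - 1

/-- `β_K(𝒢) = inf_q s^q_K(𝒢)`. -/
noncomputable def beta (K : Type*) [Field K] {V : ℕ → Type u}
    (G : ∀ n, SimpleGraph (V n)) : ℝ :=
  ⨅ q : ℕ, sInv K G q

/-- A large girth sequence: for every `k ≥ 1`, all but finitely many `G_n` contain no cycle of
length at most `k`. -/
def LargeGirth {V : ℕ → Type u} (G : ∀ n, SimpleGraph (V n)) : Prop :=
  ∀ k : ℕ, 1 ≤ k → ∃ N : ℕ, ∀ n, N ≤ n →
    ∀ (x : V n) (c : (G n).Walk x x), c.IsCycle → k < c.length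

/-- The set of edges of `G` whose two endpoints lie in different classes of the partition given
by the fibres of `P`. -/
def crossEdges {V : Type u} (G : SimpleGraph V) (P : V → ℕ) : Set (Sym2 V) :=
  {e | e ∈ G.edgeSet ∧ ∃ x ∈ e, ∃ y ∈ e, P x ≠ P y}

/-- Hyperfiniteness of a graph sequence. -/
def Hyperfinite {V : ℕ → Type u} (G : ∀ n, SimpleGraph (V n)) : Prop :=
  ∀ ε : ℝ, 0 < ε → ∃ Kb : ℕ, ∃ P : ∀ n, V n → ℕ,
    (∀ n i, {x : V n | P n x = i}.ncard ≤ Kb) ∧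
      liminf (fun n => ((crossEdges (G n) (P n)).ncard : ℝ) / (Nat.card (V n) : ℝ)) atTop ≤ ε

/-- The Cayley graph of a group with respect to a (symmetric) set `T`:
`x ~ y` iff `x ≠ y` and `y x⁻¹ ∈ T` (or `x y⁻¹ ∈ T`). -/
def cayley (Q : Type u) [Group Q] (T : Set Q) : SimpleGraph Q :=
  SimpleGraph.fromRel (fun x y => y * x⁻¹ ∈ T)

/-- The Cayley graph of the quotient `Γ ⧸ N` with respect to the image of `S`. -/
def cayleyQuot {Γ : Type u} [Group Γ] (N : Subgroup Γ) (hN : N.Normal) (S : Set Γ) :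
    SimpleGraph (Γ ⧸ N) :=
  haveI := hN
  cayley (Γ ⧸ N) ((fun g => (QuotientGroup.mk g : Γ ⧸ N)) '' S)

/-- The minimal number of generators of a group. -/
noncomputable def minGens (Λ : Type u) [Group Λ] : ℕ :=
  sInf {d : ℕ | ∃ T : Set Λ, T.Finite ∧ T.ncard = d ∧ Subgroup.closure T = ⊤}

/-- A group is finitely presented. -/
def FinitelyPresentedGroup (Γ : Type u) [Group Γ] : Prop :=
  ∃ (n : ℕ) (f : FreeGroup (Fin n) →* Γ) (R : Set (FreeGroup (Fin n))),
    Surjective f ∧ R.Finite ∧ f.ker = Subgroup.normalClosure R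

/-- Amenability via the Følner condition. -/
def IsAmenableFolner (Γ : Type u) [Group Γ] : Prop :=
  ∀ F : Set Γ, F.Finite → ∀ ε : ℝ, 0 < ε →
    ∃ A : Set Γ, A.Finite ∧ A.Nonempty ∧
      ∀ s ∈ F, (((s • A) ∆ A).ncard : ℝ) ≤ ε * A.ncard

/-- The set of edges of `G` joining `F` to its complement. -/
def edgeBoundary {V : Type u} (G : SimpleGraph V) (F : Set V) : Set (Sym2 V) :=
  {e | e ∈ G.edgeSet ∧ ∃ x ∈ e, ∃ y ∈ e, x ∈ F ∧ y ∉ F}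

/-- The sum of a function of two vertices along the darts of a walk. -/
noncomputable def walkSum {K : Type*} [Field K] {V : Type u} {G : SimpleGraph V}
    (f : V → V → K) {x y : V} (w : G.Walk x y) : K :=
  (w.darts.map fun d => f d.fst d.snd).sum

section WalkSum

variable {K : Type*} [Field K] {V : Type u} {G : SimpleGraph V}

@[simp] lemma walkSum_nil (f : V → V → K) (x : V) :
    walkSum f (SimpleGraph.Walk.nil : G.Walk x x) = 0 := by
  simp [walkSum]

@[simp] lemma walkSum_cons (f : V → V → K) {x y z : V} (h : G.Adj x y) (w : G.Walk y z) :
    walkSum f (.cons h w) = f x y + walkSum f w := by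
  simp [walkSum]

lemma walkSum_append (f : V → V → K) {x y z : V} (v : G.Walk x y) (w : G.Walk y z) :
    walkSum f (v.append w) = walkSum f v + walkSum f w := by
  simp [walkSum]

lemma walkSum_of_isPath_of_mem_edges (f : V → V → K) {u v : V} (w : G.Walk v u)
    (hw : w.IsPath) (he : s(u, v) ∈ w.edges) : walkSum f w = f v u := by
  cases w with
  | nil => simp at he
  | @cons _ v' _ h w =>
    rw [SimpleGraph.Walk.cons_isPath_iff] at hw
    rw [SimpleGraph.Walk.edges_cons, List.mem_cons] at he
    rcases he with he | he
    · rw [Sym2.eq_iff] at he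
      rcases he with ⟨h1, h2⟩ | ⟨h1, -⟩
      · exact absurd h2 h.ne
      · subst h1
        rw [SimpleGraph.Walk.eq_nil_iff_nil.mpr (SimpleGraph.Walk.isPath_iff_nil.mp hw.1)]
        simp
    · exact absurd (w.snd_mem_support_of_mem_edges he) hw.2

lemma walkSum_bypass (f : V → V → K) (hanti : ∀ x y, f x y = - f y x) (q : ℕ)
    (hcyc : ∀ (x : V) (c : G.Walk x x), c.IsCycle → c.length ≤ q → walkSum f c = 0) {x y : V}
    (w : G.Walk x y) (hw : w.length ≤ q) : walkSum f w.bypass = walkSum f w := by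
  induction w with
  | nil => simp [SimpleGraph.Walk.bypass]
  | @cons u v t h w ih =>
    rw [SimpleGraph.Walk.length_cons] at hw
    rw [walkSum_cons, ← ih (by omega), SimpleGraph.Walk.bypass]
    split_ifs with hs
    · have hpath : (w.bypass.takeUntil u hs).IsPath := w.bypass_isPath.takeUntil hs
      have hsplit : walkSum f w.bypass =
          walkSum f (w.bypass.takeUntil u hs) + walkSum f (w.bypass.dropUntil u hs) := by
        rw [← walkSum_append, SimpleGraph.Walk.take_spec]
      rw [hsplit, ← add_assoc]
      suffices f u v + walkSum f (w.bypass.takeUntil u hs) = 0 by rw [this, zero_add]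
      by_cases he : s(u, v) ∈ (w.bypass.takeUntil u hs).edges
      · rw [walkSum_of_isPath_of_mem_edges f _ hpath he, hanti u v, neg_add_cancel]
      · rw [← walkSum_cons f h]
        refine hcyc u _ ((SimpleGraph.Walk.cons_isCycle_iff _ h).mpr ⟨hpath, he⟩) ?_
        have h1 := w.bypass.length_takeUntil_le_length hs
        have h2 := w.length_bypass_le_length
        rw [SimpleGraph.Walk.length_cons]
        omega
    · rw [walkSum_cons]

lemma walkSum_closed_eq_zero (f : V → V → K) (hanti : ∀ x y, f x y = - f y x) (q : ℕ)
    (hcyc : ∀ (x : V) (c : G.Walk x x), c.IsCycle → c.length ≤ q → walkSum f c = 0) {x : V}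
    (w : G.Walk x x) (hw : w.length ≤ q) : walkSum f w = 0 := by
  rw [← walkSum_bypass f hanti q hcyc w hw,
    SimpleGraph.Walk.eq_nil_iff_nil.mpr (SimpleGraph.Walk.isPath_iff_nil.mp w.bypass_isPath), walkSum_nil]

lemma edgeVec_mem_edgeSpace {x y : V} (h : G.Adj x y) : edgeVec K x y ∈ edgeSpace K G := by
  have hne := h.ne
  refine ⟨fun a b hab => ?_, fun a b => ?_⟩
  · have h1 : ¬ (a = x ∧ b = y) := by rintro ⟨rfl, rfl⟩; exact hab h
    have h2 : ¬ (a = y ∧ b = x) := by rintro ⟨rfl, rfl⟩; exact hab h.symm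
    simp [edgeVec, h1, h2]
  · by_cases h1 : a = x ∧ b = y
    · obtain ⟨rfl, rfl⟩ := h1
      simp [edgeVec, hne]
    · by_cases h2 : a = y ∧ b = x
      · obtain ⟨rfl, rfl⟩ := h2
        simp [edgeVec, hne, hne.symm]
      · have h3 : ¬ (b = x ∧ a = y) := fun h => h2 ⟨h.2, h.1⟩
        have h4 : ¬ (b = y ∧ a = x) := fun h => h1 ⟨h.2, h.1⟩
        simp only [edgeVec, h1, h2, h3, h4, if_false, neg_zero]

lemma walkVec_mem_edgeSpace {x y : V} (w : G.Walk x y) : walkVec K w ∈ edgeSpace K G := by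
  induction w with
  | nil => exact zero_mem _
  | cons h w ih => exact add_mem (edgeVec_mem_edgeSpace h) ih

lemma cycleSpace_le_edgeSpace (q : ℕ) : cycleSpace K G q ≤ edgeSpace K G := by
  refine Submodule.span_le.mpr ?_
  rintro _ ⟨x, c, -, -, rfl⟩
  exact walkVec_mem_edgeSpace c

lemma cycleSpace_mono {q q' : ℕ} (h : q ≤ q') : cycleSpace K G q ≤ cycleSpace K G q' := by
  refine Submodule.span_mono ?_
  rintro _ ⟨x, c, hc, hl, rfl⟩
  exact ⟨x, c, hc, hl.trans h, rfl⟩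

variable (K G)

/-- The values of an antisymmetric function on arbitrarily chosen orientations of the edges. -/
noncomputable def edgeValues : edgeSpace K G →ₗ[K] (G.edgeSet → K) where
  toFun f e := f.1 (Quot.out e.1).1 (Quot.out e.1).2
  map_add' _ _ := rfl
  map_smul' _ _ := rfl

variable {K G}

lemma out_eq_or_out_eq_swap (x y : V) :
    (Quot.out s(x, y) = (x, y)) ∨ (Quot.out s(x, y) = (y, x)) := by
  have h : s((Quot.out s(x, y)).1, (Quot.out s(x, y)).2) = s(x, y) := Quot.out_eq s(x, y)
  rw [Sym2.eq_iff] at h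
  rcases h with ⟨h1, h2⟩ | ⟨h1, h2⟩
  · exact Or.inl (Prod.ext h1 h2)
  · exact Or.inr (Prod.ext h1 h2)

lemma edgeValues_edgeVec {x y : V} (h : G.Adj x y) (f : edgeSpace K G) (e : G.edgeSet) :
    edgeValues K G f e * edgeValues K G ⟨edgeVec K x y, edgeVec_mem_edgeSpace h⟩ e =
      if e = ⟨s(x, y), h⟩ then f.1 x y else 0 := by
  have hne := h.ne
  split_ifs with he
  · subst he
    simp only [edgeValues, LinearMap.coe_mk, AddHom.coe_mk]
    rcases out_eq_or_out_eq_swap x y with ho | ho <;> rw [ho]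
    · simp [edgeVec]
    · simp [edgeVec, hne, hne.symm, f.2.2 y x]
  · simp only [edgeValues, LinearMap.coe_mk, AddHom.coe_mk]
    have hout : s((Quot.out e.1).1, (Quot.out e.1).2) = e.1 := Quot.out_eq e.1
    have h1 : ¬ ((Quot.out e.1).1 = x ∧ (Quot.out e.1).2 = y) := fun ⟨a, b⟩ =>
      he (Subtype.ext (by rw [← hout, a, b]))
    have h2 : ¬ ((Quot.out e.1).1 = y ∧ (Quot.out e.1).2 = x) := fun ⟨a, b⟩ =>
      he (Subtype.ext (by rw [← hout, a, b, Sym2.eq_swap]))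
    simp only [edgeVec, h1, h2, if_false, mul_zero]

variable [Finite V]

lemma edgeValues_bijective : Bijective (edgeValues K G) := by
  have : Fintype G.edgeSet := Fintype.ofFinite _
  constructor
  · rw [← LinearMap.ker_eq_bot, LinearMap.ker_eq_bot']
    intro f hf
    ext x y
    by_cases h : G.Adj x y
    · have := edgeValues_edgeVec h f ⟨s(x, y), h⟩
      rw [hf] at this
      simpa using this.symm
    · exact f.2.1 x y h
  · rw [← LinearMap.range_eq_top, eq_top_iff, ← (Pi.basisFun K G.edgeSet).span_eq,
      Submodule.span_le]
    rintro _ ⟨⟨e, he⟩, rfl⟩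
    have hout : s((Quot.out e).1, (Quot.out e).2) = e := Quot.out_eq e
    have hadj : G.Adj (Quot.out e).1 (Quot.out e).2 := by
      rw [← SimpleGraph.mem_edgeSet, hout]; exact he
    refine ⟨⟨_, edgeVec_mem_edgeSpace hadj⟩, ?_⟩
    ext ⟨e', he'⟩
    have key := edgeValues_edgeVec (K := K) hadj ⟨_, edgeVec_mem_edgeSpace hadj⟩ ⟨e', he'⟩
    by_cases hee : e' = e
    · subst hee
      simp [edgeValues, edgeVec]
    · have hne : (⟨e', he'⟩ : G.edgeSet) ≠ ⟨s((Quot.out e).1, (Quot.out e).2), hadj⟩ :=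
        fun h => hee ((congrArg Subtype.val h).trans hout)
      rw [if_neg hne] at key
      rw [mul_self_eq_zero.mp key]
      simp [hee]

lemma finrank_edgeSpace : Module.finrank K (edgeSpace K G) = G.edgeSet.ncard := by
  have : Fintype G.edgeSet := Fintype.ofFinite _
  rw [(LinearEquiv.ofBijective _ (edgeValues_bijective (K := K) (G := G))).finrank_eq,
    Module.finrank_fintype_fun_eq_card, ← Nat.card_eq_fintype_card, Nat.card_coe_set_eq]

lemma finrank_cycleSpace_le (q : ℕ) :
    Module.finrank K (cycleSpace K G q) ≤ G.edgeSet.ncard := by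
  rw [← finrank_edgeSpace (K := K)]
  exact Submodule.finrank_mono (cycleSpace_le_edgeSpace q)

variable (K G) in
/-- The antisymmetric edge functions whose sum along every cycle of length at most `q`
vanishes. -/
noncomputable def cocycleSpace (q : ℕ) : Submodule K (V → V → K) where
  carrier := {f | f ∈ edgeSpace K G ∧
    ∀ (x : V) (c : G.Walk x x), c.IsCycle → c.length ≤ q → walkSum f c = 0}
  add_mem' := by
    rintro f g ⟨hf, hf'⟩ ⟨hg, hg'⟩
    refine ⟨add_mem hf hg, fun x c hc hl => ?_⟩
    have h1 := hf' x c hc hl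
    have h2 := hg' x c hc hl
    simp only [walkSum] at h1 h2 ⊢
    simp [List.sum_map_add, h1, h2]
  zero_mem' := ⟨zero_mem _, fun x c _ _ => by simp [walkSum]⟩
  smul_mem' := by
    rintro a f ⟨hf, hf'⟩
    refine ⟨Submodule.smul_mem _ _ hf, fun x c hc hl => ?_⟩
    have h1 := hf' x c hc hl
    simp only [walkSum] at h1 ⊢
    simp [List.sum_map_mul_left, h1]

lemma finrank_cocycleSpace_add_finrank_cycleSpace (q : ℕ) :
    Module.finrank K (cocycleSpace K G q) + Module.finrank K (cycleSpace K G q) =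
      G.edgeSet.ncard := by
  have : Fintype G.edgeSet := Fintype.ofFinite _
  let e := LinearEquiv.ofBijective _ (edgeValues_bijective (K := K) (G := G))
  let T : edgeSpace K G ≃ₗ[K] Module.Dual K (edgeSpace K G) :=
    e.trans ((dotProductEquiv K G.edgeSet).trans e.dualMap)
  have hT : ∀ f g : edgeSpace K G,
      T f g = ∑ i, edgeValues K G f i * edgeValues K G g i := fun f g => rfl
  have hedge (f : edgeSpace K G) {x y : V} (h : G.Adj x y) :
      T f ⟨edgeVec K x y, edgeVec_mem_edgeSpace h⟩ = f.1 x y := by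
    rw [hT, Finset.sum_congr rfl fun i _ => edgeValues_edgeVec h f i]
    simp
  have hwalk (f : edgeSpace K G) {x y : V} (w : G.Walk x y) :
      T f ⟨walkVec K w, walkVec_mem_edgeSpace w⟩ = walkSum f.1 w := by
    induction w with
    | nil => exact (T f).map_zero.trans (walkSum_nil _ _).symm
    | cons h w ih =>
      rw [walkSum_cons, ← ih, ← hedge f h, ← map_add]
      rfl
  let C := (cycleSpace K G q).comap (edgeSpace K G).subtype
  have hC : C = Submodule.span K {g | ∃ (x : V) (c : G.Walk x x), c.IsCycle ∧ c.length ≤ q ∧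
      g = ⟨walkVec K c, walkVec_mem_edgeSpace c⟩} := by
    apply Submodule.map_injective_of_injective (edgeSpace K G).subtype_injective
    rw [Submodule.map_comap_subtype, inf_eq_right.mpr (cycleSpace_le_edgeSpace q),
      Submodule.map_span, cycleSpace]
    congr 1
    ext g
    constructor
    · rintro ⟨x, c, hc, hl, rfl⟩
      exact ⟨_, ⟨x, c, hc, hl, rfl⟩, rfl⟩
    · rintro ⟨_, ⟨x, c, hc, hl, rfl⟩, rfl⟩
      exact ⟨x, c, hc, hl, rfl⟩
  have hZ : C.dualAnnihilator.comap T.toLinearMap =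
      (cocycleSpace K G q).comap (edgeSpace K G).subtype := by
    ext f
    rw [Submodule.mem_comap, Submodule.mem_dualAnnihilator, Submodule.mem_comap, hC]
    constructor
    · intro h
      refine ⟨f.2, fun x c hc hl => ?_⟩
      rw [Submodule.subtype_apply, ← hwalk]
      exact h _ (Submodule.subset_span ⟨x, c, hc, hl, rfl⟩)
    · intro h g hg
      induction hg using Submodule.span_induction with
      | mem g hg =>
        obtain ⟨x, c, hc, hl, rfl⟩ := hg
        exact (hwalk f c).trans (h.2 x c hc hl)
      | zero => simp
      | add a b _ _ ha hb => rw [map_add, ha, hb, add_zero]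
      | smul r a _ ha => rw [map_smul, ha, smul_zero]
  have h1 : Module.finrank K (cocycleSpace K G q) = Module.finrank K C.dualAnnihilator := by
    rw [← (Submodule.comapSubtypeEquivOfLe
      (show cocycleSpace K G q ≤ edgeSpace K G from fun f hf => hf.1)).finrank_eq, ← hZ]
    exact (T.submoduleMap _).finrank_eq.trans (by
      rw [Submodule.map_comap_eq_of_surjective T.surjective])
  have h2 : Module.finrank K (cycleSpace K G q) = Module.finrank K C :=
    (Submodule.comapSubtypeEquivOfLe (cycleSpace_le_edgeSpace q)).finrank_eq.symm
  rw [h1, h2, add_comm, Subspace.finrank_add_finrank_dualAnnihilator_eq, finrank_edgeSpace]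

end WalkSum

section Group

variable {Γ : Type u} [Group Γ] {K : Type*} [Field K] {S : Set Γ} {N : Subgroup Γ}

variable (K N) in
/-- The functions on `Γ` whose increments are invariant under right translation by `N`. -/
def quasiInvariant : Submodule K (Γ → K) where
  carrier := {F | ∀ g, ∀ n ∈ N, F (g * n) = F g + F n - F 1}
  add_mem' := by
    intro F F' h h' g n hn
    simp only [Pi.add_apply, h g n hn, h' g n hn]
    ring
  zero_mem' := by simp
  smul_mem' := by
    intro c F h g n hn
    simp only [Pi.smul_apply, smul_eq_mul, h g n hn]
    ring

lemma out_inv_mul_mem (N : Subgroup Γ) (g : Γ) : (g : Γ ⧸ N).out⁻¹ * g ∈ N :=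
  QuotientGroup.eq.mp (Quotient.out_eq (g : Γ ⧸ N))

variable (K N) in
/-- The function on `Γ` with prescribed values on coset representatives and prescribed
restriction to `N`. -/
noncomputable def extendHom :
    ((Additive (Abelianization ↥N) →ₗ[ℤ] K) × (Γ ⧸ N → K)) →ₗ[K] quasiInvariant K N where
  toFun ψ := ⟨fun g => ψ.2 g +
      ψ.1 (Additive.ofMul (Abelianization.of ⟨_, out_inv_mul_mem N g⟩)), by
    have hψ (a b : N) : ψ.1 (Additive.ofMul (Abelianization.of (a * b))) =
        ψ.1 (Additive.ofMul (Abelianization.of a)) +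
          ψ.1 (Additive.ofMul (Abelianization.of b)) := by
      rw [map_mul, ofMul_mul, map_add]
    have key (g n : Γ) (hn : n ∈ N) : ψ.2 (g * n : Γ) + ψ.1 (Additive.ofMul
        (Abelianization.of ⟨_, out_inv_mul_mem N (g * n)⟩)) = ψ.2 g + ψ.1 (Additive.ofMul
        (Abelianization.of ⟨_, out_inv_mul_mem N g⟩)) +
          ψ.1 (Additive.ofMul (Abelianization.of ⟨n, hn⟩)) := by
      have hq : ((g * n : Γ) : Γ ⧸ N) = g := QuotientGroup.mk_mul_of_mem g hn
      have hm : (⟨_, out_inv_mul_mem N (g * n)⟩ : N) = ⟨_, out_inv_mul_mem N g⟩ * ⟨n, hn⟩ := by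
        ext
        simp only [hq, Subgroup.coe_mul, mul_assoc]
      rw [hm, hψ, hq, add_assoc]
    intro g n hn
    have h1 := key 1 n hn
    rw [one_mul] at h1
    simp only [key g n hn, h1]
    ring⟩
  map_add' ψ ψ' := by
    ext g
    simp only [Prod.snd_add, Prod.fst_add, Pi.add_apply, LinearMap.add_apply, Submodule.coe_add]
    ring
  map_smul' c ψ := by
    ext g
    simp [mul_add]

lemma extendHom_apply (ψ : (Additive (Abelianization ↥N) →ₗ[ℤ] K) × (Γ ⧸ N → K)) (g : Γ) :
    (extendHom K N ψ).1 g = ψ.2 g +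
      ψ.1 (Additive.ofMul (Abelianization.of ⟨_, out_inv_mul_mem N g⟩)) := rfl

lemma extendHom_apply_out_mul (ψ : (Additive (Abelianization ↥N) →ₗ[ℤ] K) × (Γ ⧸ N → K))
    (x : Γ ⧸ N) (n : N) : (extendHom K N ψ).1 (x.out * n) =
      ψ.2 x + ψ.1 (Additive.ofMul (Abelianization.of n)) := by
  have hq : ((x.out * n : Γ) : Γ ⧸ N) = x := by
    rw [QuotientGroup.mk_mul_of_mem _ n.2, QuotientGroup.out_eq']
  have hm : (⟨_, out_inv_mul_mem N (x.out * n)⟩ : N) = n := by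
    ext
    simp only [hq, inv_mul_cancel_left]
  rw [extendHom_apply, hm, hq]

lemma extendHom_bijective : Bijective (extendHom K N) := by
  constructor
  · rw [← LinearMap.ker_eq_bot, LinearMap.ker_eq_bot']
    intro ψ hψ
    have h (x : Γ ⧸ N) (n : N) :
        ψ.2 x + ψ.1 (Additive.ofMul (Abelianization.of n)) = 0 := by
      rw [← extendHom_apply_out_mul, hψ]
      rfl
    have h2 : ψ.2 = 0 := by
      ext x
      simpa using h x 1
    refine Prod.ext ?_ h2
    ext a
    obtain ⟨n, hn⟩ := QuotientGroup.mk_surjective (Additive.toMul a)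
    have := h ((1 : Γ) : Γ ⧸ N) n
    rw [h2, Pi.zero_apply, zero_add] at this
    rw [Prod.fst_zero, LinearMap.zero_apply, ← this]
    exact congrArg (fun b => ψ.1 (Additive.ofMul b)) hn.symm
  · intro F
    let θ : N →* Multiplicative K :=
      { toFun := fun n => Multiplicative.ofAdd (F.1 n - F.1 1)
        map_one' := by simp
        map_mul' := fun a b => by
          rw [← ofAdd_add, Subgroup.coe_mul, F.2 a b b.2]
          congr 1
          ring }
    refine ⟨⟨(MonoidHom.toAdditiveLeft (Abelianization.lift θ)).toIntLinearMap,
      fun x => F.1 x.out⟩, ?_⟩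
    ext g
    rw [extendHom_apply]
    have h := F.2 (g : Γ ⧸ N).out _ (out_inv_mul_mem N g)
    rw [mul_inv_cancel_left] at h
    rw [h, add_sub_assoc]
    rfl

lemma finrank_quasiInvariant [N.FiniteIndex] [Group.FG Γ] :
    Module.finrank K (quasiInvariant K N) =
      Module.finrank K (K ⊗[ℤ] Additive (Abelianization ↥N)) + N.index := by
  have : Group.FG ↥N := N.fg_of_index_ne_zero
  have : Group.FG (Abelianization ↥N) := QuotientGroup.fg _
  have : Module.Finite ℤ (Additive (Abelianization ↥N)) :=
    Module.Finite.iff_addGroup_fg.mpr inferInstance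
  have e : (Additive (Abelianization ↥N) →ₗ[ℤ] K) ≃ₗ[K]
      Module.Dual K (K ⊗[ℤ] Additive (Abelianization ↥N)) := LinearMap.liftBaseChangeEquiv K
  have : Module.Finite K (Additive (Abelianization ↥N) →ₗ[ℤ] K) := Module.Finite.equiv e.symm
  have : Fintype (Γ ⧸ N) := Fintype.ofFinite _
  rw [← (LinearEquiv.ofBijective _ (extendHom_bijective (K := K) (N := N))).finrank_eq,
    Module.finrank_prod, e.finrank_eq, Subspace.dual_finrank_eq,
    Module.finrank_fintype_fun_eq_card, ← Nat.card_eq_fintype_card]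
  rfl

lemma cayleyQuot_adj_iff [hN : N.Normal] (hSsym : ∀ s ∈ S, s⁻¹ ∈ S) {x y : Γ ⧸ N} :
    (cayleyQuot N hN S).Adj x y ↔ x ≠ y ∧ ∃ s ∈ S, (s : Γ ⧸ N) * x = y := by
  simp only [cayleyQuot, cayley, SimpleGraph.fromRel_adj, Set.mem_image]
  refine and_congr_right fun _ => ⟨?_, ?_⟩
  · rintro (⟨s, hs, h⟩ | ⟨s, hs, h⟩)
    · exact ⟨s, hs, by rw [h, inv_mul_cancel_right]⟩
    · refine ⟨s⁻¹, hSsym s hs, ?_⟩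
      rw [QuotientGroup.mk_inv, h, mul_inv_rev, inv_inv, inv_mul_cancel_right]
  · rintro ⟨s, hs, h⟩
    exact Or.inl ⟨s, hs, by rw [← h, mul_inv_cancel_right]⟩

/-- No product of at most `m` elements of `S` is a nontrivial element of `N`. -/
def ShortWordsInjective (S : Set Γ) (N : Subgroup Γ) (m : ℕ) : Prop :=
  ∀ l : List Γ, (∀ g ∈ l, g ∈ S) → l.length ≤ m → l.prod ∈ N → l.prod = 1

lemma ShortWordsInjective.eq {m : ℕ} (h : ShortWordsInjective S N m) (hm : 2 ≤ m)
    (hSsym : ∀ s ∈ S, s⁻¹ ∈ S) {s t : Γ} (hs : s ∈ S) (ht : t ∈ S) (hst : s⁻¹ * t ∈ N) :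
    s = t := by
  have := h [s⁻¹, t] (by simp [hSsym s hs, ht]) (by simpa using hm) (by simpa using hst)
  simpa [inv_mul_eq_one] using this

variable (K N S) in
/-- The antisymmetric edge function given by the increments of a function on `Γ`. -/
noncomputable def increment [N.Normal] : (Γ → K) →ₗ[K] (Γ ⧸ N → Γ ⧸ N → K) where
  toFun F x y := if h : ∃ s ∈ S, (s : Γ ⧸ N) * x = y then F (h.choose * x.out) - F x.out else 0
  map_add' F F' := by
    ext x y
    simp only [Pi.add_apply]
    split_ifs <;> ring
  map_smul' c F := by
    ext x y
    simp only [Pi.smul_apply, smul_eq_mul, RingHom.id_apply]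
    split_ifs <;> ring

lemma increment_of_not_exists [N.Normal] (F : Γ → K) {x y : Γ ⧸ N}
    (h : ¬ ∃ s ∈ S, (s : Γ ⧸ N) * x = y) : increment K S N F x y = 0 :=
  dif_neg h

lemma increment_apply [N.Normal] {m : ℕ} (hinj : ShortWordsInjective S N m) (hm : 2 ≤ m)
    (hSsym : ∀ s ∈ S, s⁻¹ ∈ S) {F : Γ → K} (hF : F ∈ quasiInvariant K N) {s : Γ} (hs : s ∈ S)
    (g : Γ) : increment K S N F g (s * g : Γ) = F (s * g) - F g := by
  have hex : ∃ t ∈ S, (t : Γ ⧸ N) * (g : Γ ⧸ N) = (s * g : Γ) := ⟨s, hs, rfl⟩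
  have hch : hex.choose = s := by
    refine hinj.eq hm hSsym hex.choose_spec.1 hs (QuotientGroup.eq.mp ?_)
    exact mul_right_cancel hex.choose_spec.2
  have hdef : increment K S N F g (s * g : Γ) =
      F (hex.choose * (g : Γ ⧸ N).out) - F (g : Γ ⧸ N).out := dif_pos hex
  have h1 := hF (g : Γ ⧸ N).out _ (out_inv_mul_mem N g)
  have h2 := hF (s * (g : Γ ⧸ N).out) _ (out_inv_mul_mem N g)
  rw [mul_inv_cancel_left] at h1
  rw [mul_assoc, mul_inv_cancel_left] at h2
  rw [hdef, hch, h1, h2]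
  ring

lemma exists_list_of_walk [hN : N.Normal] {m : ℕ} (hinj : ShortWordsInjective S N m)
    (hm : 2 ≤ m) (hSsym : ∀ s ∈ S, s⁻¹ ∈ S) {F : Γ → K} (hF : F ∈ quasiInvariant K N)
    {x y : Γ ⧸ N} (w : (cayleyQuot N hN S).Walk x y) :
    ∃ l : List Γ, (∀ g ∈ l, g ∈ S) ∧ l.length = w.length ∧ (l.prod : Γ ⧸ N) * x = y ∧
      ∀ g : Γ, (g : Γ ⧸ N) = x → walkSum (increment K S N F) w = F (l.prod * g) - F g := by
  induction w with
  | nil => exact ⟨[], by simp, rfl, by simp, by simp⟩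
  | cons h w ih =>
    obtain ⟨l, hl, hlen, hprod, hsum⟩ := ih
    obtain ⟨-, s, hs, rfl⟩ := (cayleyQuot_adj_iff hSsym).mp h
    refine ⟨l ++ [s], ?_, by simp [hlen], ?_, ?_⟩
    · simpa [or_imp, forall_and, hs] using hl
    · rw [← hprod]
      simp [mul_assoc]
    · rintro g rfl
      have h1 := increment_apply hinj hm hSsym hF hs g
      have h2 := hsum (s * g) rfl
      rw [walkSum_cons, h2, ← QuotientGroup.mk_mul, h1]
      simp [mul_assoc]

lemma increment_mem_cocycleSpace [hN : N.Normal] {m q : ℕ} (hinj : ShortWordsInjective S N m)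
    (hm : 2 ≤ m) (hqm : q ≤ m) (hSsym : ∀ s ∈ S, s⁻¹ ∈ S) {F : Γ → K}
    (hF : F ∈ quasiInvariant K N) :
    increment K S N F ∈ cocycleSpace K (cayleyQuot N hN S) q := by
  have happ := fun {s : Γ} => increment_apply (s := s) hinj hm hSsym hF
  refine ⟨⟨fun x y hxy => ?_, fun x y => ?_⟩, fun x c _ hc => ?_⟩
  · by_cases h : ∃ s ∈ S, (s : Γ ⧸ N) * x = y
    · have hx : x = y := by
        by_contra hne
        exact hxy ((cayleyQuot_adj_iff hSsym).mpr ⟨hne, h⟩)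
      obtain ⟨s, hs, hsx⟩ := h
      obtain ⟨g, rfl⟩ := QuotientGroup.mk_surjective x
      have hs1 : s = 1 := by
        have hsN : s ∈ N := by
          rw [← QuotientGroup.eq_one_iff, ← mul_eq_right (b := (g : Γ ⧸ N)), hsx, hx]
        simpa using hinj [s] (by simpa using hs) (by simp; omega) (by simpa using hsN)
      subst hs1
      rw [← hsx, ← QuotientGroup.mk_mul, happ hs]
      simp
    · exact increment_of_not_exists F h
  · by_cases h : ∃ s ∈ S, (s : Γ ⧸ N) * x = y
    · obtain ⟨s, hs, rfl⟩ := h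
      obtain ⟨g, rfl⟩ := QuotientGroup.mk_surjective x
      have h1 := happ hs g
      have h2 := happ (hSsym s hs) (s * g)
      rw [inv_mul_cancel_left] at h2
      rw [← QuotientGroup.mk_mul, h1, h2]
      ring
    · rw [increment_of_not_exists F h, increment_of_not_exists F, neg_zero]
      rintro ⟨s, hs, rfl⟩
      exact h ⟨s⁻¹, hSsym s hs, by simp⟩
  · obtain ⟨l, hl, hlen, hprod, hsum⟩ := exists_list_of_walk hinj hm hSsym hF c
    obtain ⟨g, rfl⟩ := QuotientGroup.mk_surjective x
    rw [hsum g rfl, hinj l hl (by omega)]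
    · simp
    · rwa [← QuotientGroup.eq_one_iff, ← mul_eq_right (b := (g : Γ ⧸ N))]

lemma eq_const_of_increment_eq_zero [N.Normal] {m : ℕ} (hinj : ShortWordsInjective S N m)
    (hm : 2 ≤ m) (hSsym : ∀ s ∈ S, s⁻¹ ∈ S) (hSgen : Subgroup.closure S = ⊤) {F : Γ → K}
    (hF : F ∈ quasiInvariant K N) (h0 : increment K S N F = 0) (g : Γ) : F g = F 1 := by
  have hstep : ∀ s ∈ S, ∀ x, F (s * x) = F x := fun s hs x => by
    have := increment_apply hinj hm hSsym hF hs x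
    rw [h0, Pi.zero_apply, Pi.zero_apply] at this
    exact (sub_eq_zero.mp this.symm)
  suffices ∀ x, F (g * x) = F x by simpa using this 1
  have hg : g ∈ Subgroup.closure S := hSgen ▸ Subgroup.mem_top g
  induction hg using Subgroup.closure_induction with
  | mem s hs => exact hstep s hs
  | one => simp
  | mul a b _ _ ha hb => intro x; rw [mul_assoc, ha, hb]
  | inv a _ ha => intro x; rw [← ha (a⁻¹ * x), mul_inv_cancel_left]

/-- The skew translation of `(Γ ⧸ N) × K` by an element `s` determined by an antisymmetric
function `f`. -/
noncomputable def skewPerm [N.Normal] (f : Γ ⧸ N → Γ ⧸ N → K) (hf : ∀ x y, f x y = - f y x)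
    (s : Γ) : Equiv.Perm ((Γ ⧸ N) × K) where
  toFun a := ((s : Γ ⧸ N) * a.1, a.2 + f a.1 ((s : Γ ⧸ N) * a.1))
  invFun a := ((s : Γ ⧸ N)⁻¹ * a.1, a.2 + f a.1 ((s : Γ ⧸ N)⁻¹ * a.1))
  left_inv a := by
    refine Prod.ext (by simp) ?_
    simp only [inv_mul_cancel_left]
    rw [hf ((s : Γ ⧸ N) * a.1) a.1]
    ring
  right_inv a := by
    refine Prod.ext (by simp) ?_
    simp only [mul_inv_cancel_left]
    rw [hf ((s : Γ ⧸ N)⁻¹ * a.1) a.1]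
    ring

lemma skewPerm_apply [N.Normal] (f : Γ ⧸ N → Γ ⧸ N → K) (hf : ∀ x y, f x y = - f y x) (s : Γ)
    (a : (Γ ⧸ N) × K) :
    skewPerm f hf s a = ((s : Γ ⧸ N) * a.1, a.2 + f a.1 ((s : Γ ⧸ N) * a.1)) := rfl

lemma skewPerm_inv [N.Normal] (f : Γ ⧸ N → Γ ⧸ N → K) (hf : ∀ x y, f x y = - f y x) (s : Γ) :
    (skewPerm f hf s)⁻¹ = skewPerm f hf s⁻¹ := by
  ext a : 1
  change ((s : Γ ⧸ N)⁻¹ * a.1, a.2 + f a.1 ((s : Γ ⧸ N)⁻¹ * a.1)) = _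
  rw [skewPerm_apply, QuotientGroup.mk_inv]

lemma exists_walk_of_word [hN : N.Normal] (hSsym : ∀ s ∈ S, s⁻¹ ∈ S)
    {f : Γ ⧸ N → Γ ⧸ N → K} (hf : f ∈ edgeSpace K (cayleyQuot N hN S))
    (L : List (S × Bool)) (x : Γ ⧸ N) :
    ∃ w : (cayleyQuot N hN S).Walk x
        ((FreeGroup.lift (Subtype.val : S → Γ) (FreeGroup.mk L) : Γ) * x),
      w.length ≤ L.length ∧ ∀ k : K,
        FreeGroup.lift (fun s : S => skewPerm f hf.2 (s : Γ)) (FreeGroup.mk L) (x, k) =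
          ((FreeGroup.lift (Subtype.val : S → Γ) (FreeGroup.mk L) : Γ) * x, k + walkSum f w) := by
  induction L with
  | nil =>
    rw [← FreeGroup.one_eq_mk, map_one, map_one, QuotientGroup.mk_one, one_mul]
    exact ⟨.nil, le_rfl, by simp⟩
  | cons a L ih =>
    obtain ⟨y, hy⟩ : ∃ y, ((FreeGroup.lift (Subtype.val : S → Γ) (FreeGroup.mk L) : Γ) :
      Γ ⧸ N) * x = y := ⟨_, rfl⟩
    rw [hy] at ih
    obtain ⟨w, hlen, hw⟩ := ih
    obtain ⟨t, ht, ht1, ht2⟩ : ∃ t ∈ S,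
        FreeGroup.lift (Subtype.val : S → Γ) (FreeGroup.mk [a]) = t ∧
        FreeGroup.lift (fun s : S => skewPerm f hf.2 (s : Γ)) (FreeGroup.mk [a]) =
          skewPerm f hf.2 t := by
      obtain ⟨⟨s, hs⟩, b⟩ := a
      cases b
      · exact ⟨s⁻¹, hSsym s hs, by simp, by simp [skewPerm_inv]⟩
      · exact ⟨s, hs, by simp, by simp⟩
    have hmk : FreeGroup.mk (a :: L) = FreeGroup.mk [a] * FreeGroup.mk L := by
      rw [FreeGroup.mul_mk]; rfl
    rw [hmk, map_mul, map_mul, ht1, ht2, QuotientGroup.mk_mul, mul_assoc, hy]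
    by_cases hadj : (cayleyQuot N hN S).Adj y (t * y)
    · refine ⟨w.concat hadj, by simpa using hlen, fun k => ?_⟩
      rw [Equiv.Perm.mul_apply, hw, skewPerm_apply, SimpleGraph.Walk.concat_eq_append,
        walkSum_append, walkSum_cons, walkSum_nil, add_zero, add_assoc]
    · have hty : (t : Γ ⧸ N) * y = y := by
        by_contra hne
        exact hadj ((cayleyQuot_adj_iff hSsym).mpr ⟨Ne.symm hne, t, ht, rfl⟩)
      have hval : ∀ k : K, skewPerm f hf.2 t (y, k) = (y, k) := fun k => by
        rw [skewPerm_apply, hf.1 _ _ hadj, add_zero, hty]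
      rw [hty]
      refine ⟨w, hlen.trans (by simp), fun k => ?_⟩
      rw [Equiv.Perm.mul_apply, hw, hval]

/-- `Γ` is presented on the generating set `S` by relators of length at most `q`. -/
def PresentedByWords (S : Set Γ) (q : ℕ) : Prop :=
  (FreeGroup.lift (Subtype.val : S → Γ)).ker ≤ Subgroup.normalClosure
    {r | ∃ L : List (S × Bool), L.length ≤ q ∧
      FreeGroup.lift (Subtype.val : S → Γ) (FreeGroup.mk L) = 1 ∧ r = FreeGroup.mk L}

lemma PresentedByWords.mono {q q' : ℕ} (h : PresentedByWords S q) (hqq : q ≤ q') :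
    PresentedByWords S q' := by
  refine h.trans (Subgroup.normalClosure_mono ?_)
  rintro _ ⟨L, hL, h1, rfl⟩
  exact ⟨L, hL.trans hqq, h1, rfl⟩

lemma lift_subtype_val_surjective (hSgen : Subgroup.closure S = ⊤) :
    Surjective (FreeGroup.lift (Subtype.val : S → Γ)) := by
  rw [← MonoidHom.range_eq_top, FreeGroup.range_lift_eq_closure, Subtype.range_coe, hSgen]

lemma exists_presentedByWords (hSfin : S.Finite) (hSgen : Subgroup.closure S = ⊤)
    (hFP : FinitelyPresentedGroup Γ) : ∃ q, PresentedByWords S q := by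
  obtain ⟨n, f, R, hf, hR, hker⟩ := hFP
  have hπ := lift_subtype_val_surjective hSgen
  set π := FreeGroup.lift (Subtype.val : S → Γ) with hπdef
  choose a ha using fun i => hπ (f (FreeGroup.of i))
  choose b hb using fun s : S => hf s
  let α : FreeGroup (Fin n) →* FreeGroup S := FreeGroup.lift a
  let β : FreeGroup S →* FreeGroup (Fin n) := FreeGroup.lift b
  have hα : π.comp α = f := by
    ext i
    simp [α, ha]
  have hβ : f.comp β = π := by
    ext s
    simp [β, hb, hπdef]
  have hSf : Finite S := hSfin
  let R' : Set (FreeGroup S) :=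
    α '' R ∪ Set.range fun s : S => (FreeGroup.of s)⁻¹ * α (b s)
  have hR' : R'.Finite := (hR.image _).union (Set.finite_range _)
  obtain ⟨q, hq⟩ := (hR'.image fun r => r.toWord.length).bddAbove
  refine ⟨q, ?_⟩
  set M := Subgroup.normalClosure {r | ∃ L : List (S × Bool), L.length ≤ q ∧
    π (FreeGroup.mk L) = 1 ∧ r = FreeGroup.mk L} with hM
  have hmem : ∀ r ∈ R', π r = 1 → r ∈ M := fun r hr h1 =>
    Subgroup.subset_normalClosure ⟨r.toWord, hq ⟨r, hr, rfl⟩, by rwa [FreeGroup.mk_toWord],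
      FreeGroup.mk_toWord.symm⟩
  have hαβ : ((QuotientGroup.mk' M).comp α).comp β = QuotientGroup.mk' M := by
    ext s
    have h1 : π ((FreeGroup.of s)⁻¹ * α (b s)) = 1 := by
      have : π (α (b s)) = s := by rw [← hb s, ← hα, MonoidHom.comp_apply]
      rw [map_mul, map_inv, this, hπdef, FreeGroup.lift_apply_of, inv_mul_cancel]
    have h2 := hmem _ (Or.inr ⟨s, rfl⟩) h1
    simpa [β] using (QuotientGroup.eq.mpr h2).symm
  have hRker : f.ker ≤ ((QuotientGroup.mk' M).comp α).ker := by
    rw [hker]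
    refine Subgroup.normalClosure_le_normal fun r hr => ?_
    have hr1 : f r = 1 := by
      rw [← MonoidHom.mem_ker, hker]
      exact Subgroup.subset_normalClosure hr
    have : α r ∈ M := hmem _ (Or.inl ⟨r, hr, rfl⟩) (by rw [← MonoidHom.comp_apply, hα, hr1])
    exact (QuotientGroup.eq_one_iff _).mpr this
  intro w hw
  have h1 : β w ∈ f.ker := by
    rw [MonoidHom.mem_ker, ← MonoidHom.comp_apply, hβ]
    exact hw
  have h2 := hRker h1
  rw [MonoidHom.mem_ker, ← MonoidHom.comp_apply, hαβ] at h2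
  exact (QuotientGroup.eq_one_iff _).mp h2

lemma exists_increment_eq [hN : N.Normal] {m q : ℕ} (hinj : ShortWordsInjective S N m)
    (hm : 2 ≤ m) (hSsym : ∀ s ∈ S, s⁻¹ ∈ S) (hSgen : Subgroup.closure S = ⊤)
    (hq : PresentedByWords S q) {f : Γ ⧸ N → Γ ⧸ N → K}
    (hf : f ∈ cocycleSpace K (cayleyQuot N hN S) q) :
    ∃ F ∈ quasiInvariant K N, increment K S N F = f := by
  have hπ := lift_subtype_val_surjective hSgen
  obtain ⟨hfE, hfcyc⟩ := hf
  have hword := exists_walk_of_word hSsym hfE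
  set π := FreeGroup.lift (Subtype.val : S → Γ) with hπdef
  set ρ := FreeGroup.lift (fun s : S => skewPerm f hfE.2 (s : Γ)) with hρdef
  have hker : π.ker ≤ ρ.ker := by
    refine hq.trans (Subgroup.normalClosure_le_normal ?_)
    rintro _ ⟨L, hL, hL1, rfl⟩
    rw [SetLike.mem_coe, MonoidHom.mem_ker]
    ext1 ⟨x, k⟩
    obtain ⟨w, hlen, hw⟩ := hword L x
    have hx : ((π (FreeGroup.mk L) : Γ) : Γ ⧸ N) * x = x := by
      rw [hL1, QuotientGroup.mk_one, one_mul]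
    rw [hw]
    have hsum : walkSum f w = 0 := by
      have hcl := walkSum_closed_eq_zero f hfE.2 q hfcyc (w.copy rfl hx)
        (by rw [SimpleGraph.Walk.length_copy]; omega)
      rwa [walkSum, SimpleGraph.Walk.darts_copy] at hcl
    rw [hsum, hx, add_zero]
    rfl
  let τ : Γ →* Equiv.Perm ((Γ ⧸ N) × K) := π.liftOfSurjective hπ ⟨ρ, hker⟩
  have hτ : ∀ w, τ (π w) = ρ w := fun w =>
    MonoidHom.liftOfRightInverse_comp_apply π _ _ ⟨ρ, hker⟩ w
  have hshift (g : Γ) (x : Γ ⧸ N) : ∃ c : K, ∀ k, τ g (x, k) = ((g : Γ ⧸ N) * x, k + c) := by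
    obtain ⟨w, rfl⟩ := hπ g
    obtain ⟨v, -, hv⟩ := hword w.toWord x
    refine ⟨walkSum f v, fun k => ?_⟩
    have h1 := hv k
    simp only [FreeGroup.mk_toWord] at h1
    rw [hτ, h1]
  choose c hc using hshift
  have hmul (g h : Γ) (x : Γ ⧸ N) : c (g * h) x = c h x + c g (h * x) := by
    have h1 := hc (g * h) x 0
    rw [map_mul, Equiv.Perm.mul_apply, hc h, hc g] at h1
    simpa using (congrArg Prod.snd h1).symm
  have hgen (s : Γ) (hs : s ∈ S) (x : Γ ⧸ N) : c s x = f x (s * x) := by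
    have h1 := hτ (FreeGroup.of ⟨s, hs⟩)
    rw [hπdef, hρdef, FreeGroup.lift_apply_of, FreeGroup.lift_apply_of] at h1
    have h2 := hc s x 0
    rw [h1, skewPerm_apply] at h2
    simpa using (congrArg Prod.snd h2).symm
  have hone : c 1 (1 : Γ ⧸ N) = 0 := by
    have := hmul 1 1 (1 : Γ ⧸ N)
    rw [mul_one, QuotientGroup.mk_one, mul_one] at this
    simpa using this
  have hF : (fun g => c g (1 : Γ ⧸ N)) ∈ quasiInvariant K N := by
    intro g n hn
    simp only
    rw [hmul, hone, (QuotientGroup.eq_one_iff n).mpr hn, mul_one]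
    ring
  refine ⟨_, hF, ?_⟩
  ext x y
  by_cases h : ∃ s ∈ S, (s : Γ ⧸ N) * x = y
  · obtain ⟨s, hs, rfl⟩ := h
    obtain ⟨g, rfl⟩ := QuotientGroup.mk_surjective x
    have h1 := increment_apply hinj hm hSsym hF hs g
    rw [← QuotientGroup.mk_mul, h1, hmul, mul_one, hgen s hs, ← QuotientGroup.mk_mul]
    ring
  · rw [increment_of_not_exists _ h]
    exact (hfE.1 _ _ fun hadj => h ((cayleyQuot_adj_iff hSsym).mp hadj).2).symm

lemma ncard_edgeSet_add_one [hN : N.Normal] [N.FiniteIndex] {m q : ℕ} (hSfin : S.Finite)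
    (hinj : ShortWordsInjective S N m) (hm : 2 ≤ m) (hqm : q ≤ m) (hSsym : ∀ s ∈ S, s⁻¹ ∈ S)
    (hSgen : Subgroup.closure S = ⊤) (hq : PresentedByWords S q) :
    (cayleyQuot N hN S).edgeSet.ncard + 1 =
      Module.finrank K (K ⊗[ℤ] Additive (Abelianization ↥N)) + N.index +
        Module.finrank K (cycleSpace K (cayleyQuot N hN S) q) := by
  have : Group.FG Γ := Group.fg_iff.mpr ⟨S, hSgen, hSfin⟩
  have hW := finrank_quasiInvariant (K := K) (N := N)
  have : Module.Finite K (quasiInvariant K N) := by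
    refine Module.finite_of_finrank_pos ?_
    have := N.index_ne_zero_of_finite
    omega
  let Φ := (increment K S N).domRestrict (quasiInvariant K N)
  have hrange : LinearMap.range Φ = cocycleSpace K (cayleyQuot N hN S) q := by
    ext f
    constructor
    · rintro ⟨F, rfl⟩
      exact increment_mem_cocycleSpace hinj hm hqm hSsym F.2
    · intro hf
      obtain ⟨F, hF, rfl⟩ := exists_increment_eq hinj hm hSsym hSgen hq hf
      exact ⟨⟨F, hF⟩, rfl⟩
  have hconst : (fun _ => 1 : Γ → K) ∈ quasiInvariant K N := fun g n _ => by simp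
  have hker : LinearMap.ker Φ = Submodule.span K {⟨_, hconst⟩} := by
    refine le_antisymm (fun F hF => ?_) ?_
    · refine Submodule.mem_span_singleton.mpr ⟨F.1 1, ?_⟩
      ext g
      have := eq_const_of_increment_eq_zero hinj hm hSsym hSgen F.2 hF g
      simp [this]
    · rw [Submodule.span_singleton_le_iff_mem, LinearMap.mem_ker]
      ext x y
      simp [Φ, increment]
  have hrn := Φ.finrank_range_add_finrank_ker
  have hne : (⟨_, hconst⟩ : quasiInvariant K N) ≠ 0 := fun h => by
    have := congrFun (congrArg Subtype.val h) 1
    exact one_ne_zero this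
  rw [hrange, hker, finrank_span_singleton hne, hW] at hrn
  have := finrank_cocycleSpace_add_finrank_cycleSpace (K := K) (G := cayleyQuot N hN S) q
  omega

lemma ncard_edgeSet_cayleyQuot_le [hN : N.Normal] [N.FiniteIndex] (hSfin : S.Finite)
    (hSsym : ∀ s ∈ S, s⁻¹ ∈ S) :
    (cayleyQuot N hN S).edgeSet.ncard ≤ S.ncard * N.index := by
  have hfin : (S ×ˢ (Set.univ : Set (Γ ⧸ N))).Finite := hSfin.prod Set.finite_univ
  have hsub : (cayleyQuot N hN S).edgeSet ⊆
      (fun a : Γ × (Γ ⧸ N) => s(a.2, (a.1 : Γ ⧸ N) * a.2)) '' (S ×ˢ Set.univ) := by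
    intro e
    induction e with
    | _ x y =>
      intro h
      obtain ⟨-, s, hs, hsx⟩ := (cayleyQuot_adj_iff hSsym).mp h
      exact ⟨(s, x), ⟨hs, trivial⟩, congrArg (fun z => s(x, z)) hsx⟩
  refine (Set.ncard_le_ncard hsub (hfin.image _)).trans ((Set.ncard_image_le hfin).trans ?_)
  rw [Set.ncard_prod, Set.ncard_univ]
  rfl

lemma eventually_shortWordsInjective (hSfin : S.Finite) {N : ℕ → Subgroup Γ}
    (hN : Antitone N) (hinter : ⨅ n, N n = ⊥) (m : ℕ) :
    ∀ᶠ n in atTop, ShortWordsInjective S (N n) m := by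
  have hfin : {l : List Γ | (∀ g ∈ l, g ∈ S) ∧ l.length ≤ m}.Finite := by
    have : Finite S := hSfin
    refine ((List.finite_length_le S m).image (List.map Subtype.val)).subset ?_
    rintro l ⟨hl, hlen⟩
    lift l to List S using hl
    exact ⟨l, by simpa using hlen, rfl⟩
  have hev : ∀ l ∈ {l : List Γ | (∀ g ∈ l, g ∈ S) ∧ l.length ≤ m},
      ∀ᶠ n in atTop, l.prod ∈ N n → l.prod = 1 := by
    intro l _
    by_cases h1 : l.prod = 1
    · exact Eventually.of_forall fun _ _ => h1
    · obtain ⟨n, hn⟩ : ∃ n, l.prod ∉ N n := by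
        by_contra! h
        exact h1 (by rwa [← Subgroup.mem_bot, ← hinter, Subgroup.mem_iInf])
      filter_upwards [eventually_ge_atTop n] with k hk hmem
      exact absurd (hN hk hmem) hn
  filter_upwards [(hfin.eventually_all).mpr hev] with n hn l hl hlen hprod
  exact hn l ⟨hl, hlen⟩ hprod

end Group

lemma liminf_add_of_tendsto {u v : ℕ → ℝ} {a : ℝ} (hu : Tendsto u atTop (nhds a))
    (hv : IsBoundedUnder (· ≥ ·) atTop v) (hv' : IsBoundedUnder (· ≤ ·) atTop v) :
    liminf (u + v) atTop = a + liminf v atTop := by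
  apply le_antisymm
  · have := liminf_add_le hu.isBoundedUnder_ge hu.isBoundedUnder_le hv hv'.isCoboundedUnder_ge
    rwa [hu.limsup_eq] at this
  · have := le_liminf_add hu.isBoundedUnder_ge hu.isBoundedUnder_le hv hv'.isCoboundedUnder_ge
    rwa [hu.liminf_eq] at this

theorem mod_p_homology_gradient_eq_beta (p : ℕ) [Fact p.Prime] {Γ : Type u} [Group Γ] (S : Set Γ)
    (hSfin : S.Finite) (hSsym : ∀ s ∈ S, s⁻¹ ∈ S) (hSgen : Subgroup.closure S = ⊤)
    (N : ℕ → Subgroup Γ) (hnorm : ∀ n, (N n).Normal)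
    (hnested : ∀ n, N (n + 1) ≤ N n) (hfi : ∀ n, (N n).FiniteIndex)
    (hinter : ⨅ n, N n = ⊥)
    (hidx : Tendsto (fun n => (N n).index) atTop atTop)
    (hFP : FinitelyPresentedGroup Γ) :
    liminf (fun n =>
        (Module.finrank (ZMod p) (ZMod p ⊗[ℤ] Additive (Abelianization ↥(N n))) : ℝ) /
          ((N n).index : ℝ)) atTop =
      beta (ZMod p) (fun n => cayleyQuot (N n) (hnorm n) S) := by
  have hN : Antitone N := antitone_nat_of_succ_le hnested
  obtain ⟨q₀, hq₀⟩ := exists_presentedByWords hSfin hSgen hFP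
  set d : ℕ → ℕ := fun n =>
    Module.finrank (ZMod p) (ZMod p ⊗[ℤ] Additive (Abelianization ↥(N n)))
  set G := fun n => cayleyQuot (N n) (hnorm n) S with hG
  set c : ℕ → ℕ → ℕ := fun q n => Module.finrank (ZMod p) (cycleSpace (ZMod p) (G n) q) with hc
  have hpos : ∀ n, (0 : ℝ) < (N n).index := fun n => by
    have := hfi n
    exact_mod_cast Nat.pos_of_ne_zero (N n).index_ne_zero_of_finite
  have hle : ∀ n, ((G n).edgeSet.ncard : ℝ) / (N n).index ≤ S.ncard := fun n => by
    have := hfi n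
    rw [div_le_iff₀ (hpos n)]
    exact_mod_cast ncard_edgeSet_cayleyQuot_le (hN := hnorm n) hSfin hSsym
  have hcle : ∀ q n, c q n ≤ (G n).edgeSet.ncard := fun q n => by
    have := hfi n
    exact finrank_cycleSpace_le q
  have hdim : ∀ q, q₀ ≤ q → ∀ᶠ n in atTop, (G n).edgeSet.ncard + 1 = d n + (N n).index + c q n :=
    fun q hq => by
      filter_upwards [eventually_shortWordsInjective hSfin hN hinter (max 2 q)] with n hn
      have := hnorm n
      have := hfi n
      exact ncard_edgeSet_add_one hSfin hn (le_max_left _ _) (le_max_right _ _) hSsym hSgen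
        (hq₀.mono hq)
  set s : ℕ → ℕ → ℝ := fun q n => (((G n).edgeSet.ncard : ℝ) - (c q n : ℝ)) / ((N n).index : ℝ)
    with hs
  have hsInv : ∀ q, sInv (ZMod p) G q = liminf (s q) atTop - 1 := fun q => rfl
  have hs0 : ∀ q n, 0 ≤ s q n := fun q n =>
    div_nonneg (sub_nonneg.mpr (by exact_mod_cast hcle q n)) (hpos n).le
  have hs1 : ∀ q n, s q n ≤ S.ncard := fun q n =>
    (div_le_div_of_nonneg_right (sub_le_self _ (Nat.cast_nonneg _)) (hpos n).le).trans (hle n)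
  have hbdd : ∀ q, IsBoundedUnder (· ≥ ·) atTop (s q) := fun q =>
    isBoundedUnder_of ⟨0, hs0 q⟩
  have hbdd' : ∀ q, IsBoundedUnder (· ≤ ·) atTop (s q) := fun q =>
    isBoundedUnder_of ⟨_, hs1 q⟩
  have hinv : Tendsto (fun n => ((N n).index : ℝ)⁻¹ - 1) atTop (nhds (-1)) := by
    have := (tendsto_inv_atTop_zero.comp
      (tendsto_natCast_atTop_atTop (R := ℝ) |>.comp hidx)).sub_const 1
    simpa using this
  have hlarge : ∀ q, q₀ ≤ q →
      liminf (fun n => (d n : ℝ) / ((N n).index : ℝ)) atTop = sInv (ZMod p) G q := by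
    intro q hq
    rw [hsInv, sub_eq_neg_add, ← liminf_add_of_tendsto hinv (hbdd q) (hbdd' q)]
    refine liminf_congr ?_
    filter_upwards [hdim q hq] with n hn
    have hn' : ((G n).edgeSet.ncard : ℝ) + 1 = d n + (N n).index + c q n := by exact_mod_cast hn
    have := (hpos n).ne'
    simp only [Pi.add_apply, hs]
    field_simp
    linarith
  have hmono : ∀ q, sInv (ZMod p) G (q + q₀) ≤ sInv (ZMod p) G q := by
    intro q
    rw [hsInv, hsInv]
    refine sub_le_sub_right (liminf_le_liminf (Eventually.of_forall fun n => ?_) (hbdd _)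
      (hbdd' q).isCoboundedUnder_ge) 1
    have := hfi n
    have hcc : c q n ≤ c (q + q₀) n :=
      Submodule.finrank_mono (cycleSpace_mono (Nat.le_add_right _ _))
    exact div_le_div_of_nonneg_right (sub_le_sub_left (by exact_mod_cast hcc) _) (hpos n).le
  have hlower : ∀ q, liminf (fun n => (d n : ℝ) / ((N n).index : ℝ)) atTop ≤ sInv (ZMod p) G q :=
    fun q => (hlarge (q + q₀) (Nat.le_add_left _ _)).trans_le (hmono q)
  refine le_antisymm (le_ciInf hlower) ?_
  rw [hlarge q₀ le_rfl]
  exact ciInf_le ⟨_, Set.forall_mem_range.mpr hlower⟩ q₀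

end GraphSeqPaper
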